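/- arXiv:1808.09754 — 2 statements merged into one kernel-verified Lean document; each statement's English description precedes it below -/
import Mathlib

section
/- Let τ > √3 and let ρ_min be a minimizing measure with support M. Then for every nonempty open totally timelike subset Ω ⊆ S² there exists a polynomial u : ℝ³ → ℝ of degree at most 2 whose restriction to Ω is not identically zero, such that M ∩ Ω ⊆ {x ∈ Ω : u(x) = 0}. -/
open MeasureTheory Set
open scoped RealInnerProductSpace ENNReal

noncomputable section

/-- Euclidean three-space. -/
abbrev E3 := EuclideanSpace ℝ (Fin 3)

/-- The unit sphere `S² ⊂ ℝ³`. -/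
def Sphere2 : Set E3 := Metric.sphere 0 1

/-- The function `D(x,y) = (1/4)(1+⟨x,y⟩)(2 − τ²(1−⟨x,y⟩))`. -/
def Dfun (τ : ℝ) (x y : E3) : ℝ :=
  (1 / 4) * (1 + ⟪x, y⟫) * (2 - τ ^ 2 * (1 - ⟪x, y⟫))

/-- The Lagrangian `L = max(0, D)`. -/
def Lfun (τ : ℝ) (x y : E3) : ℝ := max 0 (Dfun τ x y)

/-- The causal action of a measure. -/
def causalAction (τ : ℝ) (ρ : Measure E3) : ℝ :=
  ∫ x, ∫ y, Lfun τ x y ∂ρ ∂ρ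

/-- `ρ` is a minimizing measure: a regular Borel probability measure supported on `S²`
minimizing the causal action among all such measures. -/
def IsMinimizer (τ : ℝ) (ρ : Measure E3) : Prop :=
  IsProbabilityMeasure ρ ∧ ρ.Regular ∧ ρ Sphere2ᶜ = 0 ∧
    ∀ ρ' : Measure E3, IsProbabilityMeasure ρ' → ρ'.Regular → ρ' Sphere2ᶜ = 0 →
      causalAction τ ρ ≤ causalAction τ ρ'

/-- The support of a measure. -/
def msupport (ρ : Measure E3) : Set E3 :=
  {x | ∀ U : Set E3, IsOpen U → x ∈ U → 0 < ρ U}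

/-- The opening angle `θ_max = arccos(1 − 2/τ²)`. -/
def θmax (τ : ℝ) : ℝ := Real.arccos (1 - 2 / τ ^ 2)

/-- The open light cone `I(p)`. -/
def lightConeI (τ : ℝ) (p : E3) : Set E3 := {q ∈ Sphere2 | 0 < Dfun τ p q}

/-- The boundary of the light cone `K(p)`. -/
def lightConeK (τ : ℝ) (p : E3) : Set E3 :=
  {q ∈ Sphere2 | ⟪p, q⟫ = Real.cos (θmax τ)}

/-- Make a point of `ℝ³` from coordinates. -/
def mkE3 (a b c : ℝ) : E3 := (WithLp.equiv 2 (Fin 3 → ℝ)).symm ![a, b, c]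

/-- A totally timelike set. -/
def TotallyTimelike (τ : ℝ) (Ω : Set E3) : Prop := ∀ x ∈ Ω, ∀ y ∈ Ω, 0 < Dfun τ x y

/-- `p` is an accumulation point of `A`: every neighborhood of `p` contains a point
of `A` different from `p`. -/
def AccumulationPt (p : E3) (A : Set E3) : Prop :=
  ∀ U ∈ nhds p, ∃ x ∈ A, x ∈ U ∧ x ≠ p

/-- `γ(0)` is a uniform two-sided accumulation point (of points of `M`) on `γ` of
scaling `β`, where `γ` is defined on `(−δ, δ)`. -/
def UniformTwoSidedAcc (M : Set E3) (β δ : ℝ) (γ : ℝ → E3) : Prop :=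
  ∃ ε₀ : ℝ, 0 < ε₀ ∧ ε₀ < δ ∧ ∀ ε : ℝ, 0 < ε → ε ≤ ε₀ →
    (∃ t ∈ Set.Ioo (-ε) (-(ε ^ (1 + β))), γ t ∈ M) ∧
    (∃ t ∈ Set.Ioo (ε ^ (1 + β)) ε, γ t ∈ M)

/-- The point `q₁ = (cos θ_max, 0, sin θ_max)`. -/
def q1pt (τ : ℝ) : E3 := mkE3 (Real.cos (θmax τ)) 0 (Real.sin (θmax τ))

/-- The point `q₂ = (cos θ_max, 0, −sin θ_max)`. -/
def q2pt (τ : ℝ) : E3 := mkE3 (Real.cos (θmax τ)) 0 (-Real.sin (θmax τ))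

/-- The curve `p_s = (cos s, sin s, 0)` along the equator. -/
def pcurve (s : ℝ) : E3 := mkE3 (Real.cos s) (Real.sin s) 0

/-- Geodesic ball in `S²` of radius `r` around `q`. -/
def geoBall (q : E3) (r : ℝ) : Set E3 := {x ∈ Sphere2 | Real.arccos ⟪q, x⟫ < r}

/-- The set `U_r = (B_r(q₁) ∪ B_r(q₂)) ∖ {q₁, q₂}`. -/
def Uset (τ r : ℝ) : Set E3 := (geoBall (q1pt τ) r ∪ geoBall (q2pt τ) r) \ {q1pt τ, q2pt τ}

/-- The set `I_r(q) = I(q) ∖ U_r`. -/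
def Iset (τ r : ℝ) (q : E3) : Set E3 := lightConeI τ q \ Uset τ r

/-- The point of `S²` with latitude `θ` (measured from the equator) and longitude `φ`. -/
def sphPt (θ φ : ℝ) : E3 :=
  mkE3 (Real.cos θ * Real.cos φ) (Real.cos θ * Real.sin φ) (Real.sin θ)

/-- The restrictions to `Ω` of polynomials of degree at most two on `ℝ³`. -/
def polyRestrictSet (Ω : Set E3) : Set (Ω → ℝ) :=
  {f | ∃ P : MvPolynomial (Fin 3) ℝ, P.totalDegree ≤ 2 ∧
        ∀ x : Ω, f x = MvPolynomial.eval (fun i => (x : E3) i) P}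

/-- The space `K(Ω)` of restrictions to `Ω` of polynomials of degree at most two. -/
def KSpace (Ω : Set E3) : Submodule ℝ (Ω → ℝ) := Submodule.span ℝ (polyRestrictSet Ω)

/-- Two-dimensional Hausdorff (surface) measure on `S²` restricted to `Ω`, as a
measure on `Ω`. -/
def surfΩ (Ω : Set E3) : Measure Ω := Measure.comap Subtype.val (μH[2] : Measure E3)

/-- The bilinear form `B(f,g) = ∫_Ω ∫_Ω D(x,y) f(x) g(y) dμ(x) dμ(y)` on functions on `Ω`. -/
def Bform (τ : ℝ) (Ω : Set E3) (f g : Ω → ℝ) : ℝ :=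
  ∫ x, ∫ y, Dfun τ (x : E3) (y : E3) * f x * g y ∂(surfΩ Ω) ∂(surfΩ Ω)

end


lemma aux_inner_le {x y : E3} (hx : x ∈ Sphere2) (hy : y ∈ Sphere2) : |⟪x, y⟫| ≤ 1 := by
  have := abs_real_inner_le_norm x y
  simp only [Sphere2, mem_sphere_zero_iff_norm] at hx hy
  rwa [hx, hy, one_mul] at this

lemma aux_D_cont (τ : ℝ) : Continuous (fun z : E3 × E3 => Dfun τ z.1 z.2) := by
  unfold Dfun; fun_prop

lemma aux_L_cont (τ : ℝ) : Continuous (fun z : E3 × E3 => Lfun τ z.1 z.2) :=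
  continuous_const.max (aux_D_cont τ)

lemma aux_L_bd (τ : ℝ) {x y : E3} (hx : x ∈ Sphere2) (hy : y ∈ Sphere2) :
    |Lfun τ x y| ≤ 1 := by
  have h := abs_le.1 (aux_inner_le hx hy)
  unfold Lfun Dfun
  generalize (⟪x, y⟫ : ℝ) = t at h
  rw [abs_of_nonneg (le_max_left _ _)]
  apply max_le zero_le_one
  nlinarith [mul_nonneg (mul_nonneg (sq_nonneg τ) (sub_nonneg.2 h.2)) (by linarith : 0 ≤ 1 + t)]

lemma aux_ae (ρ : Measure E3) [IsProbabilityMeasure ρ] (h0 : ρ Sphere2ᶜ = 0) :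
    ∀ᵐ z ∂(ρ.prod ρ), z.1 ∈ Sphere2 ∧ z.2 ∈ Sphere2 := by
  have h : ∀ᵐ x ∂ρ, x ∈ Sphere2 := by
    rw [ae_iff]; exact h0
  have h1 := Measure.quasiMeasurePreserving_fst (μ := ρ) (ν := ρ) |>.ae h
  have h2 := Measure.quasiMeasurePreserving_snd (μ := ρ) (ν := ρ) |>.ae h
  filter_upwards [h1, h2] with z a b using ⟨a, b⟩

lemma aux_L_int (τ : ℝ) (ρ : Measure E3) [IsProbabilityMeasure ρ] (h0 : ρ Sphere2ᶜ = 0)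
    (f g : E3 → ℝ) (hf : Measurable f) (hg : Measurable g) (A B : ℝ) (hA : ∀ x, |f x| ≤ A)
    (hB : ∀ x, |g x| ≤ B) :
    Integrable (fun z : E3 × E3 => f z.1 * (g z.2 * Lfun τ z.1 z.2)) (ρ.prod ρ) := by
  apply Integrable.of_bound (C := A * (B * 1))
  · apply Measurable.aestronglyMeasurable
    have := (aux_L_cont τ).measurable
    fun_prop
  · filter_upwards [aux_ae ρ h0] with z hz
    have hL := aux_L_bd τ hz.1 hz.2
    rw [Real.norm_eq_abs, abs_mul, abs_mul]
    have := (abs_nonneg _).trans (hA z.1)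
    have := (abs_nonneg _).trans (hB z.2)
    gcongr
    · exact hA _
    · exact hB _

lemma aux_var1 (τ : ℝ) (ρ : Measure E3) (hmin : IsMinimizer τ ρ)
    (g : E3 → ℝ) (hg : Measurable g) (hg1 : ∀ x, 1 / 2 ≤ g x) (hg2 : ∀ x, g x ≤ 3 / 2) :
    causalAction τ ρ * (∫ x, g x ∂ρ) ^ 2 ≤
      ∫ z, g z.1 * (g z.2 * Lfun τ z.1 z.2) ∂(ρ.prod ρ) := by
  obtain ⟨hp, hr, h0, hm⟩ := hmin
  have habs : ∀ x, |g x| ≤ 3 / 2 := fun x => abs_le.2 ⟨by linarith [hg1 x], hg2 x⟩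
  have hgi : Integrable g ρ := Integrable.of_bound hg.aestronglyMeasurable (3/2)
    (Filter.Eventually.of_forall habs)
  set c := ∫ x, g x ∂ρ with hc
  have hcpos : 0 < c := by
    have : ∫ x, (1/2 : ℝ) ∂ρ ≤ c := integral_mono (integrable_const _) hgi hg1
    simp at this
    linarith
  have hnn : ∀ x, 0 ≤ g x / c := fun x => div_nonneg (by linarith [hg1 x]) hcpos.le
  have hmeas : Measurable (fun x => ENNReal.ofReal (g x / c)) := by fun_prop
  have hfin : ∀ᵐ x ∂ρ, ENNReal.ofReal (g x / c) < ⊤ :=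
    Filter.Eventually.of_forall fun x => ENNReal.ofReal_lt_top
  let ρ' := ρ.withDensity (fun x => ENNReal.ofReal (g x / c))
  have hp' : IsProbabilityMeasure ρ' := by
    constructor
    simp only [ρ']
    rw [withDensity_apply _ MeasurableSet.univ, Measure.restrict_univ,
      ← ofReal_integral_eq_lintegral_ofReal (hgi.div_const c) (Filter.Eventually.of_forall hnn),
      integral_div, ← hc, div_self hcpos.ne', ENNReal.ofReal_one]
  have h := hm ρ' hp' inferInstance (withDensity_absolutelyContinuous _ _ h0)
  have hcalc : causalAction τ ρ' =
      (∫ z, g z.1 * (g z.2 * Lfun τ z.1 z.2) ∂(ρ.prod ρ)) / c ^ 2 := by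
    unfold causalAction
    simp only [ρ']
    rw [integral_withDensity_eq_integral_toReal_smul hmeas hfin]
    simp_rw [integral_withDensity_eq_integral_toReal_smul hmeas hfin]
    rw [integral_prod _ (aux_L_int τ ρ h0 g g hg hg _ _ habs habs), ← integral_div]
    congr 1
    ext x
    simp only [smul_eq_mul, ENNReal.toReal_ofReal (hnn _)]
    rw [integral_const_mul, div_mul_eq_mul_div]
    have : ∀ y, g y / c * Lfun τ x y = (g y * Lfun τ x y) / c := fun y => by ring
    simp_rw [this]
    rw [integral_div]
    field_simp
  rw [hcalc, le_div_iff₀ (by positivity)] at h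
  exact h

lemma aux_var2 (τ : ℝ) (ρ : Measure E3) (hmin : IsMinimizer τ ρ)
    (f : E3 → ℝ) (hf : Measurable f) (A : ℝ) (hA : ∀ x, |f x| ≤ A) :
    0 ≤ ∫ z, f z.1 * (f z.2 * Lfun τ z.1 z.2) ∂(ρ.prod ρ) := by
  have := hmin.1
  have h0 := hmin.2.2.1
  have hA0 : 0 ≤ A := (abs_nonneg _).trans (hA 0)
  obtain ⟨ε, hε, hεA⟩ : ∃ ε : ℝ, 0 < ε ∧ ε * A ≤ 1 / 2 := by
    refine ⟨1 / (2 * (A + 1)), by positivity, ?_⟩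
    rw [div_mul_eq_mul_div, div_le_iff₀ (by positivity)]
    linarith
  have hb : ∀ x, |ε * f x| ≤ 1 / 2 := fun x => by
    rw [abs_mul, abs_of_pos hε]
    exact (mul_le_mul_of_nonneg_left (hA x) hε.le).trans hεA
  have hfi : Integrable f ρ := Integrable.of_bound hf.aestronglyMeasurable A
    (Filter.Eventually.of_forall hA)
  have h1 := aux_var1 τ ρ hmin (fun x => 1 + ε * f x) (by fun_prop)
    (fun x => by linarith [(abs_le.1 (hb x)).1]) (fun x => by linarith [(abs_le.1 (hb x)).2])
  have h2 := aux_var1 τ ρ hmin (fun x => 1 - ε * f x) (by fun_prop)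
    (fun x => by linarith [(abs_le.1 (hb x)).2]) (fun x => by linarith [(abs_le.1 (hb x)).1])
  have one_b : ∀ x : E3, |(fun _ => 1 : E3 → ℝ) x| ≤ 1 := fun x => by simp
  have i11 := aux_L_int τ ρ h0 (fun _ => 1) (fun _ => 1) (by fun_prop) (by fun_prop) 1 1 one_b one_b
  have i1f := aux_L_int τ ρ h0 (fun _ => 1) f (by fun_prop) hf 1 A one_b hA
  have if1 := aux_L_int τ ρ h0 f (fun _ => 1) hf (by fun_prop) A 1 hA one_b
  have iff := aux_L_int τ ρ h0 f f hf hf A A hA hA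
  have hS : causalAction τ ρ = ∫ z : E3 × E3, 1 * (1 * Lfun τ z.1 z.2) ∂(ρ.prod ρ) := by
    rw [integral_prod _ i11]; simp [causalAction]
  have hSn : 0 ≤ causalAction τ ρ := by
    rw [hS]
    exact integral_nonneg fun z => by simp [Lfun]
  have key : ∀ s : ℝ, ∫ z : E3 × E3, (1 + s * f z.1) * ((1 + s * f z.2) * Lfun τ z.1 z.2) ∂(ρ.prod ρ)
      = causalAction τ ρ + s * (∫ z : E3 × E3, 1 * (f z.2 * Lfun τ z.1 z.2) ∂(ρ.prod ρ)) +
        s * (∫ z : E3 × E3, f z.1 * (1 * Lfun τ z.1 z.2) ∂(ρ.prod ρ)) +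
        s ^ 2 * (∫ z : E3 × E3, f z.1 * (f z.2 * Lfun τ z.1 z.2) ∂(ρ.prod ρ)) := by
    intro s
    have j1 : Integrable (fun z : E3 × E3 => 1 * (1 * Lfun τ z.1 z.2) +
        s * (1 * (f z.2 * Lfun τ z.1 z.2))) (ρ.prod ρ) := i11.add (i1f.const_mul s)
    have j2 : Integrable (fun z : E3 × E3 => 1 * (1 * Lfun τ z.1 z.2) +
        s * (1 * (f z.2 * Lfun τ z.1 z.2)) + s * (f z.1 * (1 * Lfun τ z.1 z.2))) (ρ.prod ρ) :=
      j1.add (if1.const_mul s)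
    rw [hS, ← integral_const_mul, ← integral_const_mul, ← integral_const_mul,
      ← integral_add i11 (i1f.const_mul s), ← integral_add j1 (if1.const_mul s),
      ← integral_add j2 (iff.const_mul (s^2))]
    congr 1
    ext z
    ring
  have k1 := key ε
  have k2 := key (-ε)
  simp only [neg_mul, ← sub_eq_add_neg] at k2
  rw [k1] at h1
  rw [k2] at h2
  have m1 : ∫ x, (1 + ε * f x) ∂ρ = 1 + ε * ∫ x, f x ∂ρ := by
    rw [integral_add (integrable_const _) (hfi.const_mul _), integral_const_mul]; simp
  have m2 : ∫ x, (1 - ε * f x) ∂ρ = 1 - ε * ∫ x, f x ∂ρ := by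
    rw [integral_sub (integrable_const _) (hfi.const_mul _), integral_const_mul]; simp
  rw [m1] at h1
  rw [m2] at h2
  have h3 : 0 ≤ ε ^ 2 * ∫ z, f z.1 * (f z.2 * Lfun τ z.1 z.2) ∂(ρ.prod ρ) := by
    nlinarith [mul_nonneg hSn (sq_nonneg (ε * ∫ x, f x ∂ρ))]
  exact nonneg_of_mul_nonneg_right h3 (by positivity)

lemma aux_an (u : MvPolynomial (Fin 3) ℝ) (U : Set E3) (hU : IsOpen U)
    (hz : ∀ x ∈ U ∩ Sphere2, MvPolynomial.eval (fun i => x i) u = 0)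
    (x : E3) (hxU : x ∈ U) (hx : ‖x‖ = 1) (v : E3) (hv : ‖v‖ = 1) (hxv : ⟪x, v⟫ = 0) (t : ℝ) :
    MvPolynomial.eval (fun i => (Real.cos t • x + Real.sin t • v : E3) i) u = 0 := by
  have han : AnalyticOnNhd ℝ
      (fun t : ℝ => MvPolynomial.eval (fun i => (Real.cos t • x + Real.sin t • v : E3) i) u) univ := by
    simp only [← MvPolynomial.coe_aeval_eq_eval, RingHom.coe_coe]
    apply AnalyticOnNhd.aeval_mvPolynomial
    intro i t _
    simp only [PiLp.add_apply, PiLp.smul_apply, smul_eq_mul]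
    exact (Real.analyticAt_cos.mul analyticAt_const).add
      (Real.analyticAt_sin.mul analyticAt_const)
  have hev : (fun t : ℝ => MvPolynomial.eval (fun i => (Real.cos t • x + Real.sin t • v : E3) i) u)
      =ᶠ[nhds 0] fun _ => 0 := by
    have hc : Continuous (fun t : ℝ => (Real.cos t • x + Real.sin t • v : E3)) := by fun_prop
    have : ∀ᶠ t in nhds (0:ℝ), (Real.cos t • x + Real.sin t • v : E3) ∈ U :=
      hc.continuousAt.eventually_mem (hU.mem_nhds (by simpa using hxU))
    filter_upwards [this] with t ht
    apply hz _ ⟨ht, ?_⟩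
    simp only [Sphere2, mem_sphere_zero_iff_norm]
    have : ‖(Real.cos t • x + Real.sin t • v : E3)‖ ^ 2 = 1 := by
      rw [norm_add_sq_real, norm_smul, norm_smul, inner_smul_left, inner_smul_right, hxv, hx, hv]
      simp
    nlinarith [norm_nonneg (Real.cos t • x + Real.sin t • v : E3)]
  exact congrFun (han.eq_of_eventuallyEq analyticOnNhd_const hev) t

lemma aux_vanish (u : MvPolynomial (Fin 3) ℝ) (U : Set E3) (hU : IsOpen U)
    (hz : ∀ x ∈ U ∩ Sphere2, MvPolynomial.eval (fun i => x i) u = 0)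
    (x : E3) (hxU : x ∈ U) (hx : ‖x‖ = 1) (y : E3) (hy : ‖y‖ = 1) :
    MvPolynomial.eval (fun i => y i) u = 0 := by
  obtain ⟨v, hv, hxv, a, b, hab, hyab⟩ : ∃ v : E3, ‖v‖ = 1 ∧ ⟪x, v⟫ = 0 ∧ ∃ a b : ℝ,
      a ^ 2 + b ^ 2 = 1 ∧ y = a • x + b • v := by
    have hxx : ⟪x, x⟫ = (1:ℝ) := by rw [real_inner_self_eq_norm_sq, hx]; norm_num
    suffices ∃ v : E3, ‖v‖ = 1 ∧ ⟪x, v⟫ = 0 ∧ ∃ a b : ℝ, y = a • x + b • v by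
      obtain ⟨v, hv, hxv, a, b, h⟩ := this
      refine ⟨v, hv, hxv, a, b, ?_, h⟩
      have : ‖y‖ ^ 2 = 1 := by rw [hy]; norm_num
      rw [h, norm_add_sq_real, norm_smul, norm_smul, inner_smul_left, inner_smul_right, hxv, hx, hv] at this
      simpa using this
    by_cases hw : y - (⟪x, y⟫ : ℝ) • x = 0
    · obtain ⟨v, hv, hvx⟩ : ∃ v : E3, ‖v‖ = 1 ∧ ⟪x, v⟫ = 0 := by
        have hne : (ℝ ∙ x)ᗮ ≠ ⊥ := by
          intro h
          rw [Submodule.orthogonal_eq_bot_iff] at h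
          have h1 := finrank_span_le_card (R := ℝ) ({x} : Set E3)
          rw [h, finrank_top] at h1
          simp at h1
        obtain ⟨w, hw, hw0⟩ := Submodule.exists_mem_ne_zero_of_ne_bot hne
        refine ⟨(‖w‖⁻¹ : ℝ) • w, norm_smul_inv_norm (𝕜 := ℝ) hw0, ?_⟩
        rw [inner_smul_right, Submodule.mem_orthogonal_singleton_iff_inner_right.1 hw, mul_zero]
      exact ⟨v, hv, hvx, ⟪x, y⟫, 0, by rw [sub_eq_zero] at hw; rw [zero_smul, add_zero]; exact hw⟩
    · set w := y - (⟪x, y⟫ : ℝ) • x with hwd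
      refine ⟨(‖w‖⁻¹ : ℝ) • w, norm_smul_inv_norm (𝕜 := ℝ) hw, ?_, ⟪x, y⟫, ‖w‖, ?_⟩
      · rw [inner_smul_right, hwd, inner_sub_right, inner_smul_right, hxx]; ring
      · rw [smul_smul, mul_inv_cancel₀ (norm_ne_zero_iff.2 hw), one_smul, hwd]; abel
  have hz' := aux_an u U hU hz x hxU hx v hv hxv (Complex.arg ⟨a, b⟩)
  have hn : ‖(⟨a, b⟩ : ℂ)‖ = 1 := by
    rw [Complex.norm_def, Complex.normSq_mk, ← sq, ← sq, hab, Real.sqrt_one]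
  have hne : (⟨a, b⟩ : ℂ) ≠ 0 := by
    intro h; rw [h] at hn; simp at hn
  rw [Complex.cos_arg hne, Complex.sin_arg, hn] at hz'
  simp only [div_one] at hz'
  rw [hyab]; exact hz'

noncomputable def auxP (τ : ℝ) (x : E3) : MvPolynomial (Fin 3) ℝ :=
  MvPolynomial.C (1 / 4) * (1 + ∑ i, MvPolynomial.C (x i) * MvPolynomial.X i) *
    (MvPolynomial.C (2 - τ ^ 2) + MvPolynomial.C (τ ^ 2) * ∑ i, MvPolynomial.C (x i) * MvPolynomial.X i)

lemma auxP_eval (τ : ℝ) (x y : E3) :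
    MvPolynomial.eval (fun i => y i) (auxP τ x) = Dfun τ x y := by
  simp only [auxP, Dfun, PiLp.inner_apply, map_mul, map_add, map_sum, MvPolynomial.eval_C,
    MvPolynomial.eval_X, map_one, Real.inner_apply]
  simp only [Fin.sum_univ_three]
  ring

lemma auxP_deg (τ : ℝ) (x : E3) : (auxP τ x).totalDegree ≤ 2 := by
  have hs : (∑ i, MvPolynomial.C (x i) * MvPolynomial.X i : MvPolynomial (Fin 3) ℝ).totalDegree ≤ 1 := by
    apply MvPolynomial.totalDegree_finsetSum_le
    intro i _
    refine (MvPolynomial.totalDegree_mul _ _).trans ?_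
    simp
  unfold auxP
  refine (MvPolynomial.totalDegree_mul _ _).trans ?_
  have h1 : (MvPolynomial.C (1 / 4) * (1 + ∑ i, MvPolynomial.C (x i) * MvPolynomial.X i) : MvPolynomial (Fin 3) ℝ).totalDegree ≤ 1 := by
    refine (MvPolynomial.totalDegree_mul _ _).trans ?_
    rw [MvPolynomial.totalDegree_C, zero_add]
    refine (MvPolynomial.totalDegree_add _ _).trans (max_le ?_ hs)
    simp
  have h2 : (MvPolynomial.C (2 - τ ^ 2) + MvPolynomial.C (τ ^ 2) * ∑ i, MvPolynomial.C (x i) * MvPolynomial.X i : MvPolynomial (Fin 3) ℝ).totalDegree ≤ 1 := by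
    refine (MvPolynomial.totalDegree_add _ _).trans (max_le (by rw [MvPolynomial.totalDegree_C]; norm_num) ?_)
    refine (MvPolynomial.totalDegree_mul _ _).trans ?_
    rw [MvPolynomial.totalDegree_C, zero_add]
    exact hs
  omega

lemma aux_cont (p : MvPolynomial (Fin 3) ℝ) :
    Continuous (fun x : E3 => MvPolynomial.eval (fun i => x i) p) :=
  (MvPolynomial.continuous_eval p).comp (by fun_prop)

lemma aux_intOn (ρ : Measure E3) [IsProbabilityMeasure ρ] (Ω : Set E3) (h : Ω ⊆ Sphere2)
    (g : E3 → ℝ) (hg : Continuous g) : IntegrableOn g Ω ρ :=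
  (hg.continuousOn.integrableOn_compact (isCompact_sphere (0 : E3) 1)).mono_set h

lemma aux_intOn2 (ρ : Measure E3) [IsProbabilityMeasure ρ] (Ω : Set E3) (h : Ω ⊆ Sphere2)
    (p q : MvPolynomial (Fin 3) ℝ) : IntegrableOn (fun x : E3 =>
      MvPolynomial.eval (fun i => x i) p * MvPolynomial.eval (fun i => x i) q) Ω ρ :=
  aux_intOn ρ Ω h _ ((aux_cont p).mul (aux_cont q))

noncomputable def auxB (ρ : Measure E3) [IsProbabilityMeasure ρ] (Ω : Set E3) (h : Ω ⊆ Sphere2) :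
    MvPolynomial.restrictTotalDegree (Fin 3) ℝ 2 →ₗ[ℝ]
      MvPolynomial.restrictTotalDegree (Fin 3) ℝ 2 →ₗ[ℝ] ℝ :=
  LinearMap.mk₂ ℝ (fun p q => ∫ x in Ω, MvPolynomial.eval (fun i => x i) p.1 *
      MvPolynomial.eval (fun i => x i) q.1 ∂ρ)
    (by
      intro p p' q
      rw [← integral_add (aux_intOn2 ρ Ω h _ _)
        (aux_intOn2 ρ Ω h _ _)]
      simp [add_mul])
    (by
      intro c p q
      rw [smul_eq_mul, ← integral_const_mul]
      simp [mul_assoc])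
    (by
      intro p p' q
      rw [← integral_add (aux_intOn2 ρ Ω h _ _)
        (aux_intOn2 ρ Ω h _ _)]
      simp [mul_add])
    (by
      intro c p q
      rw [smul_eq_mul, ← integral_const_mul]
      simp [mul_left_comm])

noncomputable def auxLam : MvPolynomial.restrictTotalDegree (Fin 3) ℝ 2 →ₗ[ℝ] ℝ where
  toFun q := ∑ j : Fin 3, (MvPolynomial.eval (fun i => (EuclideanSpace.single j (1:ℝ) : E3) i) q.1 +
    MvPolynomial.eval (fun i => (-EuclideanSpace.single j (1:ℝ) : E3) i) q.1)
  map_add' p q := by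
    simp only [Submodule.coe_add, map_add, ← Finset.sum_add_distrib]
    exact Finset.sum_congr rfl fun j _ => by ring
  map_smul' c q := by
    simp only [Submodule.coe_smul, MvPolynomial.smul_eval, RingHom.id_apply, smul_eq_mul, Finset.mul_sum]
    exact Finset.sum_congr rfl fun j _ => by ring

lemma aux_D_symm (τ : ℝ) (x y : E3) : Dfun τ x y = Dfun τ y x := by
  unfold Dfun; rw [real_inner_comm]

lemma aux_exists (ρ : Measure E3) [IsProbabilityMeasure ρ] (Ω : Set E3) (h : Ω ⊆ Sphere2)
    (hz : ∀ q : MvPolynomial.restrictTotalDegree (Fin 3) ℝ 2, auxB ρ Ω h q q = 0 → auxLam q = 0) :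
    ∃ p, auxB ρ Ω h p = auxLam := by
  have : auxLam ∈ (LinearMap.range (auxB ρ Ω h)) := by
    have e := Subspace.dualCoannihilator_dualAnnihilator_eq (W := LinearMap.range (auxB ρ Ω h))
    rw [← e, Submodule.mem_dualAnnihilator]
    intro q hq
    rw [Submodule.mem_dualCoannihilator] at hq
    exact hz q (hq _ ⟨q, rfl⟩)
  exact this

/-- Theorem 4.4, nodal set method: on every nonempty open totally
timelike set `Ω`, the support lies on the zero set of a quadratic polynomial whose
restriction to `Ω` is nontrivial. -/
theorem stmt_6 (τ : ℝ) (hτ : Real.sqrt 3 < τ) (ρ : Measure E3) (hmin : IsMinimizer τ ρ)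
    (Ω : Set E3) (hne : Ω.Nonempty)
    (hopen : ∃ U : Set E3, IsOpen U ∧ Ω = U ∩ Sphere2) (htt : TotallyTimelike τ Ω) :
    ∃ u : MvPolynomial (Fin 3) ℝ, u.totalDegree ≤ 2 ∧
      (¬ ∀ x ∈ Ω, MvPolynomial.eval (fun i => x i) u = 0) ∧
      msupport ρ ∩ Ω ⊆ {x ∈ Ω | MvPolynomial.eval (fun i => x i) u = 0} := by
  by_contra hcon
  push Not at hcon
  obtain ⟨U, hU, rfl⟩ := hopen
  have hsub : U ∩ Sphere2 ⊆ Sphere2 := inter_subset_right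
  have hp := hmin.1
  have hmeasΩ : MeasurableSet (U ∩ Sphere2) :=
    hU.measurableSet.inter Metric.isClosed_sphere.measurableSet
  obtain ⟨x0, hx0U, hx0S⟩ := hne
  have hx0 : ‖x0‖ = 1 := by simpa [Sphere2] using hx0S
  obtain ⟨p, hpB⟩ : ∃ p, auxB ρ (U ∩ Sphere2) hsub p = auxLam := by
    apply aux_exists
    intro q hq
    have hΩ : ∀ x ∈ U ∩ Sphere2, MvPolynomial.eval (fun i => x i) q.1 = 0 := by
      by_contra hnot
      push Not at hnot
      apply hcon q.1 ((MvPolynomial.mem_restrictTotalDegree _ _ _).1 q.2) hnot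
      rintro x ⟨hxM, hxΩ⟩
      refine ⟨hxΩ, ?_⟩
      by_contra hne
      have hopn : IsOpen (U ∩ {y : E3 | MvPolynomial.eval (fun i => y i) q.1 ≠ 0}) :=
        hU.inter (isOpen_ne_fun (aux_cont q.1) continuous_const)
      have hpos := hxM _ hopn ⟨hxΩ.1, hne⟩
      have hq' : ∫ x in U ∩ Sphere2, MvPolynomial.eval (fun i => x i) q.1 *
        MvPolynomial.eval (fun i => x i) q.1 ∂ρ = 0 := hq
      rw [setIntegral_eq_zero_iff_of_nonneg_ae
        (Filter.Eventually.of_forall fun x => mul_self_nonneg _)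
        (aux_intOn ρ _ hsub _ ((aux_cont _).mul (aux_cont _)))] at hq'
      have hq2 := (ae_restrict_iff' hmeasΩ).1 hq'
      rw [ae_iff] at hq2
      have h0 := hmin.2.2.1
      refine hpos.ne' (measure_mono_null ?_ (measure_union_null hq2 h0))
      intro y hy
      by_cases hyS : y ∈ Sphere2
      · left
        intro hh
        have := hh ⟨hy.1, hyS⟩
        simp at this
        exact hy.2 this
      · right; exact hyS
    have hall := aux_vanish q.1 U hU hΩ x0 hx0U hx0
    simp only [auxLam, LinearMap.coe_mk, AddHom.coe_mk]
    apply Finset.sum_eq_zero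
    intro j _
    rw [hall _ (by simp), hall _ (by simp), add_zero]
  have hB : ∀ x : E3, ∫ y in U ∩ Sphere2, MvPolynomial.eval (fun i => y i) p.1 * Dfun τ x y ∂ρ =
      ∑ j : Fin 3, (Dfun τ x (EuclideanSpace.single j (1:ℝ)) +
        Dfun τ x (-EuclideanSpace.single j (1:ℝ))) := by
    intro x
    have := LinearMap.congr_fun hpB
      ⟨auxP τ x, (MvPolynomial.mem_restrictTotalDegree _ _ _).2 (auxP_deg τ x)⟩
    simp only [auxB, auxLam, LinearMap.mk₂_apply, LinearMap.coe_mk, AddHom.coe_mk, auxP_eval] at this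
    exact this
  set f : E3 → ℝ := (U ∩ Sphere2).indicator (fun x => MvPolynomial.eval (fun i => x i) p.1) with hf
  have hfm : Measurable f := (aux_cont p.1).measurable.indicator hmeasΩ
  obtain ⟨A, hA⟩ : ∃ A, ∀ x, |f x| ≤ A := by
    obtain ⟨A, hA⟩ := (isCompact_sphere (0 : E3) 1).exists_bound_of_continuousOn
      (aux_cont p.1).continuousOn
    refine ⟨max A 0, fun x => ?_⟩
    by_cases hx : x ∈ U ∩ Sphere2
    · rw [hf, indicator_of_mem hx]
      exact (hA x hx.2).trans (le_max_left _ _)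
    · rw [hf, indicator_of_notMem hx]; simp
  have hnn := aux_var2 τ ρ hmin f hfm A hA
  have hLD : ∀ x y, f x * (f y * Lfun τ x y) = f x * (f y * Dfun τ x y) := by
    intro x y
    by_cases hx : x ∈ U ∩ Sphere2
    · by_cases hy : y ∈ U ∩ Sphere2
      · rw [Lfun, max_eq_right (htt x hx y hy).le]
      · simp [hf, indicator_of_notMem hy]
    · simp [hf, indicator_of_notMem hx]
  rw [integral_prod _ (aux_L_int τ ρ hmin.2.2.1 f f hfm hfm A A hA hA)] at hnn
  simp only [hLD] at hnn
  have hfi : ∀ g : E3 → ℝ, ∫ y, f y * g y ∂ρ =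
      ∫ y in U ∩ Sphere2, MvPolynomial.eval (fun i => y i) p.1 * g y ∂ρ := by
    intro g
    rw [← integral_indicator hmeasΩ]
    congr 1
    ext y
    by_cases hy : y ∈ U ∩ Sphere2
    · simp [hf, indicator_of_mem hy]
    · simp [hf, indicator_of_notMem hy]
  simp only [integral_const_mul] at hnn
  simp only [hfi] at hnn
  simp only [hB] at hnn
  have hint : ∀ z : E3, IntegrableOn
      (fun x => MvPolynomial.eval (fun i => x i) p.1 * Dfun τ x z) (U ∩ Sphere2) ρ := fun z =>
    aux_intOn ρ _ hsub _ ((aux_cont _).mul ((aux_D_cont τ).comp (by fun_prop : Continuous fun x : E3 => (x, z))))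
  have hB' : ∀ z : E3, ∫ x in U ∩ Sphere2, MvPolynomial.eval (fun i => x i) p.1 * Dfun τ x z ∂ρ =
      ∑ j : Fin 3, (Dfun τ z (EuclideanSpace.single j (1:ℝ)) +
        Dfun τ z (-EuclideanSpace.single j (1:ℝ))) := by
    intro z
    rw [← hB z]
    simp only [aux_D_symm τ z]
  simp only [Finset.mul_sum, mul_add] at hnn
  have hint2 : ∀ z w : E3, IntegrableOn (fun x => MvPolynomial.eval (fun i => x i) p.1 * Dfun τ x z +
      MvPolynomial.eval (fun i => x i) p.1 * Dfun τ x w) (U ∩ Sphere2) ρ := fun z w =>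
    (hint z).add (hint w)
  rw [integral_finsetSum _ (fun j _ => hint2 _ _)] at hnn
  simp only [integral_add (hint _) (hint _), hB'] at hnn
  have h3 : 3 < τ ^ 2 := by
    have := Real.lt_sq_of_sqrt_lt hτ
    exact this
  simp [Fin.sum_univ_three, Dfun, EuclideanSpace.inner_single_left] at hnn
  nlinarith
end

section
/- Let τ > √6 and let ρ_min be a minimizing measure with support M. If p ∈ M, then K(p) ∩ M is non-empty. -/
open MeasureTheory Set
open scoped RealInnerProductSpace ENNReal

theorem aux_int (μ : Measure E3) [IsFiniteMeasure μ] (h : μ Sphere2ᶜ = 0) (f : E3 → ℝ)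
    (hf : Continuous f) : Integrable f μ := by
  have hr : μ.restrict Sphere2 = μ := Measure.restrict_eq_self_of_ae_mem (by
    rw [ae_iff]; exact h)
  rw [← hr]
  exact hf.continuousOn.integrableOn_compact (isCompact_sphere 0 1)

theorem aux_cont_s7 (μ : Measure E3) [IsFiniteMeasure μ] (h : μ Sphere2ᶜ = 0) (f : E3 → E3 → ℝ)
    (hf : Continuous (Function.uncurry f)) : Continuous (fun x => ∫ y, f x y ∂μ) := by
  have hr : μ.restrict Sphere2 = μ := Measure.restrict_eq_self_of_ae_mem (by
    rw [ae_iff]; exact h)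
  rw [← hr]
  exact continuous_parametric_integral_of_continuous hf (isCompact_sphere 0 1)

theorem aux_Lcont (τ : ℝ) : Continuous (Function.uncurry (Lfun τ)) := by
  unfold Function.uncurry Lfun Dfun
  fun_prop

theorem aux_Lcont1 (τ : ℝ) (x : E3) : Continuous (Lfun τ x) := by
  unfold Lfun Dfun
  fun_prop

theorem aux_Lsymm (τ : ℝ) (x y : E3) : Lfun τ x y = Lfun τ y x := by
  unfold Lfun Dfun
  rw [real_inner_comm]

theorem aux_EL1 (τ : ℝ) (ρ : Measure E3) (hmin : IsMinimizer τ ρ) (q : E3) (hq : q ∈ Sphere2) :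
    causalAction τ ρ ≤ ∫ y, Lfun τ q y ∂ρ := by
  obtain ⟨hP, hR, h0, hm⟩ := hmin
  set S := causalAction τ ρ with hS
  set l := ∫ y, Lfun τ q y ∂ρ with hl
  have key : ∀ s : ℝ, 0 < s → s < 1 →
      S ≤ (1-s)^2 * S + 2*s*(1-s)*l + s^2 * Lfun τ q q := by
    intro s hs hs1
    let μ : Measure E3 := ENNReal.ofReal (1-s) • ρ + ENNReal.ofReal s • Measure.dirac q
    have hPμ : IsProbabilityMeasure μ := ⟨by
      simp only [μ, Measure.add_apply, Measure.smul_apply, measure_univ, smul_eq_mul, mul_one]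
      rw [← ENNReal.ofReal_add (by linarith) hs.le]; simp⟩
    have hμ0 : μ Sphere2ᶜ = 0 := by
      simp only [μ, Measure.add_apply, Measure.smul_apply, h0, smul_eq_mul, mul_zero, zero_add]
      have hms : MeasurableSet Sphere2 := Metric.isClosed_sphere.measurableSet
      rw [Measure.dirac_apply' _ hms.compl]
      simp [hq]
    have hint : ∀ f : E3 → ℝ, Continuous f → ∫ x, f x ∂μ = (1-s) * ∫ x, f x ∂ρ + s * f q := by
      intro f hf
      have h1 : Integrable f ρ := aux_int ρ h0 f hf
      have h2 : Integrable f (Measure.dirac q) := integrable_dirac (by simp)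
      rw [integral_add_measure (h1.smul_measure ENNReal.ofReal_ne_top)
        (h2.smul_measure ENNReal.ofReal_ne_top), integral_smul_measure, integral_smul_measure,
        integral_dirac, ENNReal.toReal_ofReal (by linarith), ENNReal.toReal_ofReal hs.le]
      simp
    have := hm μ hPμ inferInstance hμ0
    refine this.trans (le_of_eq ?_)
    unfold causalAction
    have e1 : ∀ x, ∫ y, Lfun τ x y ∂μ = (1-s) * ∫ y, Lfun τ x y ∂ρ + s * Lfun τ q x := by
      intro x
      rw [hint _ (aux_Lcont1 τ x), aux_Lsymm τ x q]
    simp_rw [e1]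
    have c1 := aux_cont_s7 ρ h0 _ (aux_Lcont τ)
    have c2 := aux_Lcont1 τ q
    rw [hint _ (by fun_prop), integral_add ((aux_int ρ h0 _ c1).const_mul _)
      ((aux_int ρ h0 _ c2).const_mul _), integral_const_mul, integral_const_mul]
    rw [← hl]
    change (1-s) * ((1-s) * S + s * l) + _ = _
    ring
  by_contra hlt
  push Not at hlt
  set C := S - 2*l + Lfun τ q q with hC
  have k2 : ∀ s : ℝ, 0 < s → s < 1 → 2 * (S - l) ≤ s * C := by
    intro s hs hs1
    have := key s hs hs1
    have h3 : s * (2 * (S - l)) ≤ s * (s * C) := by rw [hC]; nlinarith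
    exact le_of_mul_le_mul_left h3 hs
  have hd : 0 < S - l := by linarith
  have hp : 0 < |C| + (S - l) + 1 := by positivity
  have := k2 ((S-l)/(|C| + (S - l) + 1)) (by positivity) (by
    rw [div_lt_one hp]; linarith [abs_nonneg C])
  have h4 : (S-l)/(|C| + (S - l) + 1) * C ≤ S - l := by
    rw [div_mul_eq_mul_div, div_le_iff₀ hp]
    have := le_abs_self C
    nlinarith
  linarith

theorem aux_EL2 (τ : ℝ) (ρ : Measure E3) (hmin : IsMinimizer τ ρ) (p : E3)
    (hp : p ∈ msupport ρ) : ∫ y, Lfun τ p y ∂ρ = causalAction τ ρ := by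
  have h1 := aux_EL1 τ ρ hmin
  obtain ⟨hP, hR, h0, -⟩ := hmin
  have c1 := aux_cont_s7 ρ h0 _ (aux_Lcont τ)
  set l : E3 → ℝ := fun x => ∫ y, Lfun τ x y ∂ρ with hl
  set S := causalAction τ ρ with hS
  have hS' : ∫ x, l x ∂ρ = S := rfl
  have hz : ∫ x, (l x - S) ∂ρ = 0 := by
    rw [integral_sub (aux_int ρ h0 _ c1) (integrable_const _), hS']; simp
  have hnn : 0 ≤ᵐ[ρ] fun x => l x - S := by
    have : ∀ᵐ x ∂ρ, x ∈ Sphere2 := by rw [ae_iff]; exact h0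
    filter_upwards [this] with x hx
    have := h1 x hx
    simp only [Pi.zero_apply]; simp only [hl]; linarith
  have hae := (integral_eq_zero_iff_of_nonneg_ae hnn
    (aux_int ρ h0 _ (c1.sub continuous_const))).1 hz
  by_contra hne
  have hU : IsOpen {x | l x ≠ S} := isOpen_ne_fun c1 continuous_const
  have := hp _ hU hne
  have h5 : ρ {x | l x ≠ S} = 0 := by
    rw [← nonpos_iff_eq_zero]
    refine (measure_mono ?_).trans (le_of_eq (ae_iff.1 hae))
    intro x hx
    simp only [Pi.zero_apply, mem_setOf_eq, sub_eq_zero]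
    exact hx
  exact this.ne' h5

/-- The profile of the Lagrangian. -/
noncomputable def gfun (τ c : ℝ) : ℝ := max 0 ((1 / 4) * (1 + c) * (2 - τ ^ 2 * (1 - c)))

theorem aux_g_pos (τ c : ℝ) (hτ : 6 < τ^2) (hc : 1 - 2/τ^2 < c) :
    gfun τ c = (1 / 4) * (1 + c) * (2 - τ ^ 2 * (1 - c)) := by
  have h1 : 2/τ^2 < 1/3 := by rw [div_lt_div_iff₀ (by linarith) (by norm_num)]; linarith
  have h2 : 1 - c < 2/τ^2 := by linarith
  rw [lt_div_iff₀ (by linarith)] at h2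
  refine max_eq_right ?_
  have : 0 ≤ 1 + c := by linarith
  have : 0 ≤ 2 - τ^2 * (1-c) := by linarith
  positivity

theorem aux_g_zero (τ c : ℝ) (hτ : 6 < τ^2) (hc : c < 1 - 2/τ^2) (h : -1 ≤ c) :
    gfun τ c = 0 := by
  have h2 : 2/τ^2 < 1 - c := by linarith
  rw [div_lt_iff₀ (by linarith)] at h2
  refine max_eq_left ?_
  have : 0 ≤ 1 + c := by linarith
  nlinarith

theorem aux_cs (u v c a : ℝ) (h : u^2+v^2=1) (h' : c^2+a^2 ≤ 1) : -1 ≤ u*c+v*a := by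
  nlinarith [sq_nonneg (u*a-v*c), sq_nonneg (u+c), sq_nonneg (v+a)]

theorem aux_near (u v c a δ : ℝ) (hu : u < 1) (hv : 0 < v) (hd : (1-u)+v < δ)
    (h' : c^2+a^2 ≤ 1) : |u*c+v*a - c| < δ := by
  have hc : |c| ≤ 1 := abs_le_one_iff_mul_self_le_one.2 (by nlinarith)
  have ha : |a| ≤ 1 := abs_le_one_iff_mul_self_le_one.2 (by nlinarith)
  rw [abs_le] at hc ha
  rw [abs_lt]
  constructor <;> nlinarith

theorem aux_pt (τ u v c a b δ : ℝ) (hτ : 6 < τ^2) (h : u^2+v^2=1) (hu : u < 1) (hv : 0 < v)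
    (hd : (1-u)+v < δ) (hs : c^2+a^2+b^2=1) (hc : δ ≤ |c - (1-2/τ^2)|) :
    gfun τ (u*c+v*a) + gfun τ (u*c+v*(-a)) + gfun τ (u*c+v*b) + gfun τ (u*c+v*(-b))
      ≤ 4 * gfun τ c ∧ (1 - 2/τ^2 < c →
    gfun τ (u*c+v*a) + gfun τ (u*c+v*(-a)) + gfun τ (u*c+v*b) + gfun τ (u*c+v*(-b))
      < 4 * gfun τ c) := by
  have i1 : c^2+a^2 ≤ 1 := by nlinarith
  have i2 : c^2+(-a)^2 ≤ 1 := by nlinarith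
  have i3 : c^2+b^2 ≤ 1 := by nlinarith
  have i4 : c^2+(-b)^2 ≤ 1 := by nlinarith
  have n1 := abs_lt.1 (aux_near u v c a δ hu hv hd i1)
  have n2 := abs_lt.1 (aux_near u v c (-a) δ hu hv hd i2)
  have n3 := abs_lt.1 (aux_near u v c b δ hu hv hd i3)
  have n4 := abs_lt.1 (aux_near u v c (-b) δ hu hv hd i4)
  have hδ : 0 < δ := by linarith
  have hstrict : 1 - 2/τ^2 < c →
    gfun τ (u*c+v*a) + gfun τ (u*c+v*(-a)) + gfun τ (u*c+v*b) + gfun τ (u*c+v*(-b))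
      < 4 * gfun τ c := by
    intro hc'
    rw [abs_of_pos (by linarith)] at hc
    rw [aux_g_pos τ _ hτ hc', aux_g_pos τ (u*c+v*a) hτ (by linarith),
      aux_g_pos τ (u*c+v*(-a)) hτ (by linarith),
      aux_g_pos τ (u*c+v*b) hτ (by linarith), aux_g_pos τ (u*c+v*(-b)) hτ (by linarith)]
    have h1 : 2/τ^2 < 1/3 := by rw [div_lt_div_iff₀ (by linarith) (by norm_num)]; linarith
    have hc3 : 2/3 < c := by linarith
    have hid : 4 * ((1 / 4) * (1 + c) * (2 - τ ^ 2 * (1 - c))) -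
      ((1 / 4) * (1 + (u*c+v*a)) * (2 - τ ^ 2 * (1 - (u*c+v*a))) +
       (1 / 4) * (1 + (u*c+v*(-a))) * (2 - τ ^ 2 * (1 - (u*c+v*(-a)))) +
       (1 / 4) * (1 + (u*c+v*b)) * (2 - τ ^ 2 * (1 - (u*c+v*b))) +
       (1 / 4) * (1 + (u*c+v*(-b))) * (2 - τ ^ 2 * (1 - (u*c+v*(-b)))))
       = 2*c*(1-u) + τ^2 * v^2 * ((3*c^2-1)/2) := by
      have hb : b^2 = 1 - c^2 - a^2 := by linarith
      have hu2 : u^2 = 1 - v^2 := by linarith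
      ring_nf
      rw [hb, hu2]
      ring
    have p1 : 0 < 2*c*(1-u) := mul_pos (by linarith) (by linarith)
    have p3 : 0 ≤ (3*c^2-1)/2 := by
      clear hid p1
      have : (2/3)*(2/3) ≤ c * c := mul_le_mul hc3.le hc3.le (by norm_num) (by linarith)
      linarith [sq c]
    have p2 : 0 ≤ τ^2 * v^2 * ((3*c^2-1)/2) :=
      mul_nonneg (mul_nonneg (sq_nonneg _) (sq_nonneg _)) p3
    linarith
  refine ⟨?_, hstrict⟩
  by_cases hc' : 1 - 2/τ^2 < c
  · exact (hstrict hc').le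
  · push Not at hc'
    rw [abs_of_nonpos (by linarith)] at hc
    rw [aux_g_zero τ (u*c+v*a) hτ (by linarith) (aux_cs u v _ _ h i1),
      aux_g_zero τ (u*c+v*(-a)) hτ (by linarith) (aux_cs u v _ _ h i2),
      aux_g_zero τ (u*c+v*b) hτ (by linarith) (aux_cs u v _ _ h i3),
      aux_g_zero τ (u*c+v*(-b)) hτ (by linarith) (aux_cs u v _ _ h i4)]
    have : 0 ≤ gfun τ c := le_max_left _ _
    linarith

theorem aux_basis (p : E3) (hp : ‖p‖ = 1) : ∃ e f : E3, ⟪p, e⟫ = 0 ∧ ⟪p, f⟫ = 0 ∧ ‖e‖ = 1 ∧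
    ‖f‖ = 1 ∧ ∀ y : E3, ⟪p, y⟫^2 + ⟪e, y⟫^2 + ⟪f, y⟫^2 = ‖y‖^2 := by
  have ho : Orthonormal ℝ (({0} : Set (Fin 3)).restrict (fun _ => p)) := by
    refine ⟨fun i => hp, fun i j hij => (hij (Subsingleton.elim _ _)).elim⟩
  obtain ⟨b, hb⟩ := ho.exists_orthonormalBasis_extension_of_card_eq (by simp)
  have hb0 : b 0 = p := hb 0 rfl
  refine ⟨b 1, b 2, ?_, ?_, b.orthonormal.1 1, b.orthonormal.1 2, ?_⟩
  · rw [← hb0]; exact b.orthonormal.2 (by decide)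
  · rw [← hb0]; exact b.orthonormal.2 (by decide)
  · intro y
    have := b.sum_sq_norm_inner_right y
    simpa [Fin.sum_univ_three, hb0] using this

theorem aux_uv (δ : ℝ) (hδ : 0 < δ) : ∃ u v : ℝ, u^2+v^2=1 ∧ u < 1 ∧ 0 < v ∧ (1-u)+v < δ := by
  have hc : Continuous (fun t => (1 - Real.cos t) + Real.sin t) := by fun_prop
  have h0 : (fun t => (1 - Real.cos t) + Real.sin t) 0 < δ := by simpa using hδ
  have h1 := (hc.tendsto 0).eventually (gt_mem_nhds h0)
  obtain ⟨ε, hε, h⟩ := Metric.eventually_nhds_iff.1 h1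
  refine ⟨Real.cos (min (ε/2) 1), Real.sin (min (ε/2) 1), Real.cos_sq_add_sin_sq _, ?_, ?_, ?_⟩
  · have h3 : min (ε/2) 1 ≤ Real.pi :=
      (min_le_right _ _).trans (by linarith [Real.pi_gt_three])
    have h4 : 0 < min (ε/2) 1 := by positivity
    have := Real.cos_lt_cos_of_nonneg_of_le_pi le_rfl h3 h4
    rwa [Real.cos_zero] at this
  · exact Real.sin_pos_of_pos_of_lt_pi (by positivity)
      ((min_le_right _ _).trans_lt (by linarith [Real.pi_gt_three]))
  · apply h
    rw [Real.dist_eq, sub_zero, abs_of_pos (by positivity)]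
    exact (min_le_left _ _).trans_lt (by linarith)

theorem aux_Lg (τ u v : ℝ) (p e y : E3) :
    Lfun τ (u • p + v • e) y = gfun τ (u * ⟪p, y⟫ + v * ⟪e, y⟫) := by
  unfold Lfun Dfun gfun
  rw [inner_add_left, real_inner_smul_left, real_inner_smul_left]

theorem aux_q (u v : ℝ) (p e : E3) (h : u^2+v^2=1) (hp : ‖p‖ = 1) (he : ‖e‖ = 1)
    (hpe : ⟪p, e⟫ = 0) : u • p + v • e ∈ Sphere2 := by
  have : ‖u • p + v • e‖^2 = 1 := by
    rw [norm_add_sq_real, real_inner_smul_left, real_inner_smul_right, hpe, norm_smul, norm_smul,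
      hp, he]
    simpa using h
  unfold Sphere2
  rw [mem_sphere_zero_iff_norm]
  nlinarith [norm_nonneg (u • p + v • e)]

/-- Lemma 5.1: for `τ > √6`, if `p ∈ M` then `K(p) ∩ M ≠ ∅`. -/
theorem stmt_7 (τ : ℝ) (hτ : Real.sqrt 6 < τ) (ρ : Measure E3) (hmin : IsMinimizer τ ρ)
    (p : E3) (hp : p ∈ msupport ρ) :
    (lightConeK τ p ∩ msupport ρ).Nonempty := by
  have hτ2 : 6 < τ^2 := Real.lt_sq_of_sqrt_lt hτ
  have hE1 := aux_EL1 τ ρ hmin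
  have hE2 := aux_EL2 τ ρ hmin p hp
  obtain ⟨hP, hR, h0, -⟩ := hmin
  have h1 : 2/τ^2 < 1/3 := by rw [div_lt_div_iff₀ (by linarith) (by norm_num)]; linarith
  have h1' : 0 < 2/τ^2 := by positivity
  have hcos : Real.cos (θmax τ) = 1 - 2/τ^2 :=
    Real.cos_arccos (by linarith) (by linarith)
  have hms : msupport ρ = ρ.support := by
    ext x
    rw [Measure.mem_support_iff_forall]
    constructor
    · intro h U hU
      obtain ⟨V, hVU, hV, hx⟩ := mem_nhds_iff.1 hU
      exact (h V hV hx).trans_le (measure_mono hVU)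
    · intro h U hU hx
      exact h U (hU.mem_nhds hx)
  have hsub : msupport ρ ⊆ Sphere2 := by
    intro x hx
    by_contra hxs
    exact (hx _ Metric.isClosed_sphere.isOpen_compl hxs).ne' h0
  have hMc : IsCompact (msupport ρ) :=
    (isCompact_sphere 0 1).of_isClosed_subset (hms ▸ Measure.isClosed_support) hsub
  have hae : ∀ᵐ y ∂ρ, y ∈ msupport ρ := by
    rw [hms]; exact Measure.support_mem_ae
  by_contra hemp
  have hne : ∀ y ∈ msupport ρ, 0 < |⟪p, y⟫ - (1 - 2/τ^2)| := by
    intro y hy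
    rw [abs_pos, sub_ne_zero]
    intro he
    exact hemp ⟨y, ⟨hsub hy, by rw [hcos, he]⟩, hy⟩
  obtain ⟨δ, hδ, hδM⟩ : ∃ δ > 0, ∀ y ∈ msupport ρ, δ ≤ |⟪p, y⟫ - (1 - 2/τ^2)| := by
    obtain ⟨y, hy, hmin⟩ := hMc.exists_isMinOn ⟨p, hp⟩
      (f := fun y => |⟪p, y⟫ - (1 - 2/τ^2)|) (by fun_prop)
    exact ⟨_, hne y hy, fun z hz => hmin hz⟩
  obtain ⟨u, v, huv, hu, hv, hd⟩ := aux_uv δ hδ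
  have hpn : ‖p‖ = 1 := mem_sphere_zero_iff_norm.1 (hsub hp)
  obtain ⟨e, f, hpe, hpf, he, hf, hbas⟩ := aux_basis p hpn
  have q1 := hE1 _ (aux_q u v p e huv hpn he hpe)
  have q2 := hE1 _ (aux_q u v p (-e) huv hpn (by simpa using he) (by simpa using hpe))
  have q3 := hE1 _ (aux_q u v p f huv hpn hf hpf)
  have q4 := hE1 _ (aux_q u v p (-f) huv hpn (by simpa using hf) (by simpa using hpf))
  have hL : ∀ x, Integrable (Lfun τ x) ρ := fun x => aux_int ρ h0 _ (aux_Lcont1 τ x)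
  let F : E3 → ℝ := fun y => 4 * Lfun τ p y - (Lfun τ (u • p + v • e) y +
    Lfun τ (u • p + v • (-e)) y + Lfun τ (u • p + v • f) y + Lfun τ (u • p + v • (-f)) y)
  have hsum := (((hL (u • p + v • e)).add (hL (u • p + v • (-e)))).add
    (hL (u • p + v • f))).add (hL (u • p + v • (-f)))
  have hFi : Integrable F ρ := ((hL p).const_mul 4).sub hsum
  have hFint : ∫ y, F y ∂ρ ≤ 0 := by
    have : ∫ y, F y ∂ρ = 4 * ∫ y, Lfun τ p y ∂ρ - (∫ y, Lfun τ (u • p + v • e) y ∂ρ +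
      ∫ y, Lfun τ (u • p + v • (-e)) y ∂ρ + ∫ y, Lfun τ (u • p + v • f) y ∂ρ +
      ∫ y, Lfun τ (u • p + v • (-f)) y ∂ρ) := by
      have e0 : ∫ y, F y ∂ρ = _ := integral_sub ((hL p).const_mul 4) hsum
      have e1 := integral_add' (((hL (u • p + v • e)).add (hL (u • p + v • (-e)))).add
        (hL (u • p + v • f))) (hL (u • p + v • (-f)))
      have e2 := integral_add' ((hL (u • p + v • e)).add (hL (u • p + v • (-e))))
        (hL (u • p + v • f))
      have e3 := integral_add' (hL (u • p + v • e)) (hL (u • p + v • (-e)))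
      simp only [Pi.add_apply] at e1 e2 e3
      rw [e0, e1, e2, e3, integral_const_mul]
    linarith
  have hF : ∀ y ∈ msupport ρ, 0 ≤ F y ∧ (1 - 2/τ^2 < ⟪p, y⟫ → 0 < F y) := by
    intro y hy
    have hyn : ‖y‖ = 1 := mem_sphere_zero_iff_norm.1 (hsub hy)
    have hb := hbas y
    rw [hyn, one_pow] at hb
    have := aux_pt τ u v _ _ _ δ hτ2 huv hu hv hd hb (hδM y hy)
    have hLp : Lfun τ p y = gfun τ ⟪p, y⟫ := rfl
    simp only [F, aux_Lg, inner_neg_left, hLp]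
    exact ⟨by linarith [this.1], fun h => by linarith [this.2 h]⟩
  have hFnn : 0 ≤ᵐ[ρ] F := by
    filter_upwards [hae] with y hy using (hF y hy).1
  have hF0 := (integral_eq_zero_iff_of_nonneg_ae hFnn hFi).1
    (le_antisymm hFint (integral_nonneg_of_ae hFnn))
  have hU : IsOpen {y : E3 | 1 - 2/τ^2 < ⟪p, y⟫} :=
    isOpen_lt continuous_const (by fun_prop)
  have hpos := hp _ hU (by
    simp only [mem_setOf_eq]
    rw [real_inner_self_eq_norm_sq, hpn]; linarith)
  have hz : ∀ᵐ y ∂ρ, ¬ (1 - 2/τ^2 < ⟪p, y⟫) := by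
    filter_upwards [hae, hF0] with y hy hy0 hlt
    exact ((hF y hy).2 hlt).ne' hy0
  rw [ae_iff] at hz
  simp only [not_not] at hz
  exact hpos.ne' hz
end
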